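/- arXiv:2004.14811 — 8 statements merged into one kernel-verified Lean document; each statement's English description precedes it below -/
import Mathlib

section
/- Let g ≥ 4 be an even integer such that g − 1 is a prime number. There do not exist an integer N with N > g, integers h ≥ 0 and l ≥ 0 with 3h − 3 + l = 4, and integers m_1, …, m_l each ≥ 2, such that 2(g−1) = N·(2h − 2 + Σ_{j=1}^{l} (1 − 1/m_j)) (the equation being between rational numbers). -/
theorem eq_add_one_of_prime_mul_succ_eq {p q N : ℤ} (hp : Prime p) (hp0 : 0 < p) (hq : 2 ≤ q)
    (h : p * (q + 1) = N * q) : N = p + 1 := by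
  have hpq : p = q * (N - p) := by linarith
  rcases hp.irreducible.isUnit_or_isUnit hpq with hu | hu
  · rcases Int.isUnit_iff.1 hu with hu | hu <;> omega
  · rcases Int.isUnit_iff.1 hu with hu | hu
    · omega
    · rw [hu] at hpq
      omega

theorem one_div_le_of_natCast_le {k n : ℕ} (hk : 0 < k) (h : k ≤ n) :
    1 / (n : ℚ) ≤ 1 / (k : ℚ) :=
  one_div_le_one_div_of_le (by exact_mod_cast hk) (by exact_mod_cast h)

/-- For `a, b ≥ 3` with `1/a + 1/b > 1/2`, the pair is `(3, 3)`, `(3, 4)` or `(3, 5)` up to order,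
and `5/2 - 1/a - 1/b` has the form `2q/(q + 1)` for an integer `q`. -/
theorem exists_signature_quotient {a b : ℕ} (ha : 3 ≤ a) (hb : 3 ≤ b)
    (hab : (1 / 2 : ℚ) < 1 / a + 1 / b) :
    ∃ q : ℤ, 2 ≤ q ∧ (5 / 2 - 1 / a - 1 / b : ℚ) = 2 * q / (q + 1) := by
  wlog hle : a ≤ b generalizing a b
  · obtain ⟨q, hq, h⟩ := this hb ha (by linarith) (by omega)
    exact ⟨q, hq, by rw [← h]; ring⟩
  obtain rfl : a = 3 := by
    by_contra hne
    have h₁ := one_div_le_of_natCast_le (k := 4) (n := a) (by omega) (by omega)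
    have h₂ := one_div_le_of_natCast_le (k := 4) (n := b) (by omega) (by omega)
    norm_num at h₁ h₂ hab
    linarith
  have hb5 : b ≤ 5 := by
    by_contra hne
    have h₁ := one_div_le_of_natCast_le (k := 6) (n := b) (by omega) (by omega)
    norm_num at h₁ hab
    linarith
  interval_cases b
  · exact ⟨11, by norm_num, by norm_num⟩
  · exact ⟨23, by norm_num, by norm_num⟩
  · exact ⟨59, by norm_num, by norm_num⟩

/-- Integers `m₁, …, m₇ ≥ 2` for which `-2 + ∑ (1 - 1/mⱼ) < 2` give this sum the
form `2q/(q + 1)` for an integer `q ≥ 2`. -/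
theorem exists_genus_zero_quotient (m : Fin 7 → ℕ) (hm : ∀ j, 2 ≤ m j)
    (hlt : -2 + ∑ j, (1 - 1 / (m j : ℚ)) < 2) :
    ∃ q : ℤ, 2 ≤ q ∧ -2 + ∑ j, (1 - 1 / (m j : ℚ)) = 2 * q / (q + 1) := by
  set S : Finset (Fin 7) := Finset.univ.filter fun j => m j ≠ 2 with hS
  have hmS : ∀ j ∈ S, 3 ≤ m j := by
    intro j hj
    have h₁ := hm j
    have h₂ : m j ≠ 2 := by simpa [hS] using hj
    omega
  have hsum : -2 + ∑ j, (1 - 1 / (m j : ℚ)) = 3 / 2 + ∑ j ∈ S, (1 / 2 - 1 / (m j : ℚ)) := by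
    have h₁ : ∑ j ∈ S, (1 / 2 - 1 / (m j : ℚ)) = ∑ j, (1 / 2 - 1 / (m j : ℚ)) := by
      refine Finset.sum_subset (Finset.subset_univ _) fun j _ hj => ?_
      have h₂ : m j = 2 := by simpa [hS] using hj
      norm_num [h₂]
    rw [h₁, Finset.sum_sub_distrib, Finset.sum_sub_distrib]
    norm_num
    ring
  have hcard : S.card < 3 := by
    have h₁ : S.card • (1 / 6 : ℚ) ≤ ∑ j ∈ S, (1 / 2 - 1 / (m j : ℚ)) := by
      refine Finset.card_nsmul_le_sum _ _ _ fun j hj => ?_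
      have h₂ := one_div_le_of_natCast_le (by norm_num) (hmS j hj)
      norm_num at h₂ ⊢
      linarith
    rw [nsmul_eq_mul] at h₁
    have h₂ : (S.card : ℚ) < 3 := by linarith
    exact_mod_cast h₂
  rw [hsum] at hlt ⊢
  interval_cases hc : S.card
  · rw [Finset.card_eq_zero.1 hc]
    exact ⟨3, by norm_num, by norm_num⟩
  · obtain ⟨a, ha⟩ := Finset.card_eq_one.1 hc
    rw [ha, Finset.sum_singleton]
    have h₁ := hm a
    have h₂ : (m a : ℚ) ≠ 0 := by
      exact_mod_cast (by omega : m a ≠ 0)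
    refine ⟨2 * m a - 1, by omega, ?_⟩
    push_cast
    rw [sub_add_cancel]
    field_simp
    ring
  · obtain ⟨a, b, hab, h⟩ := Finset.card_eq_two.1 hc
    rw [h, Finset.sum_pair hab] at hlt ⊢
    obtain ⟨q, hq, h₁⟩ := exists_signature_quotient (hmS a (by simp [h])) (hmS b (by simp [h]))
      (by linarith)
    exact ⟨q, hq, by rw [← h₁]; ring⟩

/-- Let `g ≥ 4` be an even integer such that `g − 1` is a prime number. There do not exist
an integer `N > g`, integers `h ≥ 0` and `l ≥ 0` with `3h − 3 + l = 4`, and integers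
`m_1, …, m_l` each `≥ 2`, such that `2(g−1) = N·(2h − 2 + Σ_{j=1}^{l} (1 − 1/m_j))`. -/
theorem stmt_5 (g : ℤ) (hg : 4 ≤ g) (hgeven : Even g) (hp : Prime (g - 1)) :
    ¬ ∃ (N : ℤ) (h l : ℕ) (m : Fin l → ℕ),
      g < N ∧
      3 * (h : ℤ) - 3 + (l : ℤ) = 4 ∧
      (∀ j, 2 ≤ m j) ∧
      (2 * ((g : ℚ) - 1) = (N : ℚ) * (2 * (h : ℚ) - 2 + ∑ j, (1 - 1 / (m j : ℚ)))) := by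
  rintro ⟨N, h, l, m, hN, hdim, hm, hRH⟩
  have hgQ : (4 : ℚ) ≤ g := by exact_mod_cast hg
  have hNQ : (g : ℚ) < N := by exact_mod_cast hN
  have hlt : 2 * (h : ℚ) - 2 + ∑ j, (1 - 1 / (m j : ℚ)) < 2 := by
    by_contra! hge
    nlinarith
  have hlow : l • (1 / 2 : ℚ) ≤ ∑ j, (1 - 1 / (m j : ℚ)) := by
    have h₁ := Finset.card_nsmul_le_sum Finset.univ (fun j => 1 - 1 / (m j : ℚ)) (1 / 2)
      fun j _ => by
        have h₂ := one_div_le_of_natCast_le (by norm_num) (hm j)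
        norm_num at h₂ ⊢
        linarith
    simpa using h₁
  rw [nsmul_eq_mul] at hlow
  have hdimQ : 3 * (h : ℚ) - 3 + l = 4 := by exact_mod_cast hdim
  have hh : h = 0 := by
    have h₁ : (h : ℚ) < 1 := by linarith
    exact_mod_cast Nat.lt_one_iff.1 (by exact_mod_cast h₁)
  subst hh
  obtain rfl : l = 7 := by omega
  norm_num only [Nat.cast_zero, mul_zero, zero_sub] at hlt hRH
  obtain ⟨q, hq, hquot⟩ := exists_genus_zero_quotient m hm (by simpa using hlt)
  have hqQ : (2 : ℚ) ≤ q := by exact_mod_cast hq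
  have hkey : (g - 1) * (q + 1) = N * q := by
    have h₁ : 2 * ((g : ℚ) - 1) = N * (2 * q / (q + 1)) := by
      rw [← hquot]
      simpa using hRH
    have h₂ : (q : ℚ) + 1 ≠ 0 := by linarith
    field_simp at h₁
    have h₃ : ((g : ℚ) - 1) * (q + 1) = N * q := by linarith
    exact_mod_cast h₃
  have := eq_add_one_of_prime_mul_succ_eq hp (by omega) hq hkey
  omega
end

section
/- Let g ≥ 4 be an even integer and set n = g/2. There exist seven elements a_1, …, a_7 of the dihedral group D_n such that a_1, …, a_6 each have order exactly 2, a_7 has order exactly n, a_1·a_2·a_3·a_4·a_5·a_6·a_7 = 1, and {a_1, …, a_7} generates D_n. (For example a_1 = ⋯ = a_5 = s, a_6 = s·r^{−1}, a_7 = r.) -/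
theorem DihedralGroup.closure_sr_zero_r_one (n : ℕ) :
    Subgroup.closure {DihedralGroup.sr 0, DihedralGroup.r (1 : ZMod n)} = ⊤ := by
  rw [eq_top_iff]
  have r_mem (i : ZMod n) : DihedralGroup.r i ∈
      Subgroup.closure {DihedralGroup.sr 0, DihedralGroup.r (1 : ZMod n)} := by
    obtain ⟨k, rfl⟩ := ZMod.intCast_surjective i
    rw [← DihedralGroup.r_one_zpow]
    exact Subgroup.zpow_mem _ (Subgroup.subset_closure (by simp)) k
  rintro (i | i) -
  · exact r_mem i
  · rw [← zero_add i, ← DihedralGroup.sr_mul_r]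
    exact Subgroup.mul_mem _ (Subgroup.subset_closure (by simp)) (r_mem i)

/-- Let `g ≥ 4` be an even integer and set `n = g/2`. There exist seven elements
`a 0, …, a 6` of the dihedral group `D_n` such that `a 0, …, a 5` each have order exactly 2,
`a 6` has order exactly `n`, their product is `1`, and they generate `D_n`. -/
theorem stmt_6 (g : ℕ) (hg : 4 ≤ g) (hgeven : Even g) :
    ∃ a : Fin 7 → DihedralGroup (g / 2),
      (∀ i : Fin 7, (i : ℕ) < 6 → orderOf (a i) = 2) ∧
      orderOf (a 6) = g / 2 ∧
      a 0 * a 1 * a 2 * a 3 * a 4 * a 5 * a 6 = 1 ∧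
      Subgroup.closure (Set.range a) = ⊤ := by
  refine ⟨![.sr 0, .sr 0, .sr 0, .sr 0, .sr 0, .sr (-1), .r 1], fun i hi => ?_,
    DihedralGroup.orderOf_r_one, ?_, ?_⟩
  · fin_cases i
    iterate 6 exact DihedralGroup.orderOf_sr _
    exact absurd hi (lt_irrefl 6)
  · simp
  · rw [eq_top_iff, ← DihedralGroup.closure_sr_zero_r_one]
    apply Subgroup.closure_mono
    rintro x (rfl | rfl)
    · exact ⟨0, rfl⟩
    · exact ⟨6, rfl⟩
end

section
/- Let g ≥ 3 be an odd integer such that g − 1 = 2^k for some integer k ≥ 1. There do not exist an integer N with N > g − 1, integers h ≥ 0 and l ≥ 0 with 3h − 3 + l = 4, and integers m_1, …, m_l each ≥ 2, such that 2(g−1) = N·(2h − 2 + Σ_{j=1}^{l} (1 − 1/m_j)) (the equation being between rational numbers). -/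
/-- A number coprime to both `2` and `c` that divides `2 ^ n * c` is a unit. -/
theorem isUnit_of_dvd_two_pow_mul {d c : ℤ} {n : ℕ} (h2 : IsCoprime d 2) (hc : IsCoprime d c)
    (h : d ∣ 2 ^ n * c) : IsUnit d :=
  ((h2.pow_right (n := n)).mul_right hc).isUnit_of_dvd' dvd_rfl h

/-- The signature `(0; 2, 2, 2, 2, 2, b, c)` with area less than `4π` does not occur when
`g - 1` is a power of two; here with `b ≤ c`. -/
theorem two_pow_mul_ne_of_le {b c N : ℤ} {n : ℕ} (hb : 2 ≤ b) (hbc : b ≤ c)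
    (hlt : b * c < 2 * b + 2 * c) : N * (5 * b * c - 2 * b - 2 * c) ≠ 2 ^ n * (4 * (b * c)) := by
  intro h
  obtain rfl | hb3 := hb.eq_or_lt
  · have hd : 2 * c - 1 ∣ 2 ^ (n + 1) * c := ⟨N, by rw [pow_succ]; linarith⟩
    have hu := isUnit_of_dvd_two_pow_mul ⟨-1, c, by ring⟩ ⟨-1, 2, by ring⟩ hd
    rcases Int.isUnit_iff.mp hu with hu | hu <;> omega
  · have hb' : b = 3 := by nlinarith
    subst hb'
    have hc : c ≤ 5 := by linarith
    interval_cases c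
    · have hu := isUnit_of_dvd_two_pow_mul (d := 11) (c := 12) (n := n) (by norm_num)
        (by norm_num) ⟨N, by linarith⟩
      norm_num [Int.isUnit_iff] at hu
    · have hu := isUnit_of_dvd_two_pow_mul (d := 23) (c := 24) (n := n) (by norm_num)
        (by norm_num) ⟨N, by linarith⟩
      norm_num [Int.isUnit_iff] at hu
    · have hu := isUnit_of_dvd_two_pow_mul (d := 59) (c := 60) (n := n) (by norm_num)
        (by norm_num) ⟨N, by linarith⟩
      norm_num [Int.isUnit_iff] at hu

/-- The signature `(0; 2, 2, 2, 2, 2, b, c)` with area less than `4π` does not occur when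
`g - 1` is a power of two. -/
theorem two_pow_mul_ne {b c N : ℤ} {n : ℕ} (hb : 2 ≤ b) (hc : 2 ≤ c)
    (hlt : b * c < 2 * b + 2 * c) : N * (5 * b * c - 2 * b - 2 * c) ≠ 2 ^ n * (4 * (b * c)) := by
  rcases le_total b c with hbc | hcb
  · exact two_pow_mul_ne_of_le hb hbc hlt
  · intro h
    exact two_pow_mul_ne_of_le (N := N) (n := n) hc hcb (by linarith) (by linarith)

/-- Among seven periods whose reciprocals sum to more than `3`, at least five equal `2`. -/
theorem exists_pair_of_three_lt_sum_inv (m : Fin 7 → ℕ) (hm : ∀ j, 2 ≤ m j)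
    (h : 3 < ∑ j, 1 / (m j : ℚ)) :
    ∃ x y, x ≠ y ∧ ∑ j, 1 / (m j : ℚ) = 5 / 2 + 1 / (m x : ℚ) + 1 / (m y : ℚ) := by
  have hle : ∑ j, 1 / (m j : ℚ) ≤ ∑ j, (1 / 2 - if m j ≠ 2 then (1 / 6 : ℚ) else 0) := by
    refine Finset.sum_le_sum fun j _ => ?_
    split_ifs with hj
    · have h3 : (3 : ℚ) ≤ m j := by exact_mod_cast (show 3 ≤ m j by have := hm j; omega)
      exact (one_div_le_one_div_of_le (by norm_num) h3).trans (by norm_num)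
    · simp [not_not.mp hj]
  rw [Finset.sum_sub_distrib, ← Finset.sum_filter] at hle
  simp only [Finset.sum_const, Finset.card_univ, Fintype.card_fin, nsmul_eq_mul] at hle
  have hcard : (Finset.univ.filter fun j => m j ≠ 2).card ≤ 2 := by
    have : ((Finset.univ.filter fun j => m j ≠ 2).card : ℚ) < 3 := by
      push_cast at hle; linarith
    have : (Finset.univ.filter fun j => m j ≠ 2).card < 3 := by exact_mod_cast this
    omega
  obtain ⟨A, hA, hA2⟩ := Finset.exists_superset_card_eq hcard (by simp)
  obtain ⟨x, y, hxy, rfl⟩ := Finset.card_eq_two.mp hA2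
  refine ⟨x, y, hxy, ?_⟩
  have hcompl : ∑ j ∈ ({x, y} : Finset (Fin 7))ᶜ, 1 / (m j : ℚ) = 5 / 2 := by
    have htwo : ∀ j ∈ ({x, y} : Finset (Fin 7))ᶜ, 1 / (m j : ℚ) = 1 / 2 := by
      intro j hj
      have : m j = 2 := by
        by_contra hne
        exact Finset.mem_compl.mp hj (hA (by simpa using hne))
      simp [this]
    rw [Finset.sum_congr rfl htwo, Finset.sum_const, Finset.card_compl, hA2]
    norm_num
  rw [← Finset.sum_add_sum_compl {x, y}, hcompl, Finset.sum_pair hxy]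
  ring

/-- Let `g ≥ 3` be an odd integer such that `g − 1 = 2^k` for some `k ≥ 1`. There do not
exist an integer `N > g − 1`, integers `h ≥ 0` and `l ≥ 0` with `3h − 3 + l = 4`, and
integers `m_1, …, m_l` each `≥ 2`, such that
`2(g−1) = N·(2h − 2 + Σ_{j=1}^{l} (1 − 1/m_j))`. -/
theorem stmt_7 (g : ℤ) (hg : 3 ≤ g) (hgodd : Odd g) (k : ℕ) (hk : 1 ≤ k)
    (hpow : g - 1 = 2 ^ k) :
    ¬ ∃ (N : ℤ) (h l : ℕ) (m : Fin l → ℕ),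
      g - 1 < N ∧
      3 * (h : ℤ) - 3 + (l : ℤ) = 4 ∧
      (∀ j, 2 ≤ m j) ∧
      (2 * ((g : ℚ) - 1) = (N : ℚ) * (2 * (h : ℚ) - 2 + ∑ j, (1 - 1 / (m j : ℚ)))) := by
  rintro ⟨N, h, l, m, hN, hdim, hm, hRH⟩
  have hG : (0 : ℚ) < (g : ℚ) - 1 := by
    have : (3 : ℚ) ≤ g := by exact_mod_cast hg
    linarith
  have hNG : (g : ℚ) - 1 < N := by exact_mod_cast hN
  have hS : 2 * (h : ℚ) - 2 + ∑ j, (1 - 1 / (m j : ℚ)) < 2 := by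
    by_contra! hS
    nlinarith
  have hhalf : ∀ j, (1 / 2 : ℚ) ≤ 1 - 1 / (m j : ℚ) := fun j => by
    have h2 : (2 : ℚ) ≤ m j := by exact_mod_cast hm j
    linarith [one_div_le_one_div_of_le (by norm_num) h2]
  have hsum : (l : ℚ) * (1 / 2) ≤ ∑ j, (1 - 1 / (m j : ℚ)) := by
    simpa using Finset.card_nsmul_le_sum Finset.univ _ _ fun j _ => hhalf j
  have hdimQ : 3 * (h : ℚ) - 3 + l = 4 := by exact_mod_cast hdim
  have hh : h = 0 := by
    have : (h : ℚ) < 1 := by linarith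
    exact_mod_cast Nat.lt_one_iff.mp (by exact_mod_cast this)
  subst hh
  obtain rfl : l = 7 := by omega
  rw [Finset.sum_sub_distrib] at hS hRH
  simp only [Finset.sum_const, Finset.card_univ, Fintype.card_fin, nsmul_eq_mul] at hS hRH
  push_cast at hS hRH
  obtain ⟨x, y, -, hxy⟩ := exists_pair_of_three_lt_sum_inv m hm (by linarith)
  rw [hxy] at hS hRH
  have hx : (0 : ℚ) < m x := by exact_mod_cast two_pos.trans_le (hm x)
  have hy : (0 : ℚ) < m y := by exact_mod_cast two_pos.trans_le (hm y)
  refine two_pow_mul_ne (b := m x) (c := m y) (N := N) (n := k) (by exact_mod_cast hm x)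
    (by exact_mod_cast hm y) ?_ ?_
  · have hlt : (1 / 2 : ℚ) < 1 / m x + 1 / m y := by linarith
    rw [div_add_div _ _ hx.ne' hy.ne', div_lt_div_iff₀ two_pos (by positivity)] at hlt
    have : (m x * m y : ℚ) < 2 * m x + 2 * m y := by linarith
    exact_mod_cast this
  · rw [← hpow]
    field_simp at hRH
    have : (N : ℚ) * (5 * m x * m y - 2 * m x - 2 * m y) = (g - 1) * (4 * (m x * m y)) := by
      linarith
    exact_mod_cast this
end

section
/- Let m ≥ 1 be an integer. There exist elements a, b, x_1, x_2, x_3, x_4 of the dihedral group D_m such that each x_i has order exactly 2, a·b·a^{−1}·b^{−1}·x_1·x_2·x_3·x_4 = 1, and {a, b, x_1, x_2, x_3, x_4} generates D_m. (For example a = b = 1, x_1 = x_2 = s and x_3 = x_4 = s·r.) -/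
/-- The dihedral group is generated by two adjacent reflections. -/
theorem DihedralGroup.closure_sr_zero_sr_one (n : ℕ) :
    Subgroup.closure {sr 0, sr 1} = (⊤ : Subgroup (DihedralGroup n)) := by
  rw [eq_top_iff]
  have h_sr : sr 0 ∈ Subgroup.closure {sr 0, (sr 1 : DihedralGroup n)} :=
    Subgroup.subset_closure (by simp)
  have h_r (i : ZMod n) : r i ∈ Subgroup.closure {sr 0, (sr 1 : DihedralGroup n)} := by
    obtain ⟨k, rfl⟩ := ZMod.intCast_surjective i
    simpa using Subgroup.zpow_mem _
      (mul_mem h_sr (Subgroup.subset_closure (by simp : sr 1 ∈ _))) k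
  rintro (i | i) -
  · exact h_r i
  · simpa using mul_mem h_sr (h_r i)

/-- Let `m ≥ 1` be an integer. There exist elements `a, b, x₁, x₂, x₃, x₄` of the dihedral
group `D_m` such that each `xᵢ` has order exactly 2, `a·b·a⁻¹·b⁻¹·x₁·x₂·x₃·x₄ = 1`, and
`{a, b, x₁, x₂, x₃, x₄}` generates `D_m`. -/
theorem stmt_9 (m : ℕ) (hm : 1 ≤ m) :
    ∃ a b x₁ x₂ x₃ x₄ : DihedralGroup m,
      orderOf x₁ = 2 ∧ orderOf x₂ = 2 ∧ orderOf x₃ = 2 ∧ orderOf x₄ = 2 ∧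
      a * b * a⁻¹ * b⁻¹ * x₁ * x₂ * x₃ * x₄ = 1 ∧
      Subgroup.closure {a, b, x₁, x₂, x₃, x₄} = ⊤ := by
  refine ⟨1, 1, .sr 0, .sr 0, .sr 1, .sr 1, DihedralGroup.orderOf_sr 0,
    DihedralGroup.orderOf_sr 0, DihedralGroup.orderOf_sr 1, DihedralGroup.orderOf_sr 1,
    by simp, ?_⟩
  rw [eq_top_iff, ← DihedralGroup.closure_sr_zero_sr_one]
  exact Subgroup.closure_mono (by simp)
end

section
/- Let g ≥ 6 be an even integer such that q = g/2 is a prime number. Suppose h ≥ 0 and l ≥ 0 are integers with 3h − 3 + l = 4, and m_1, …, m_l are integers, each ≥ 2 and each dividing 2q, satisfying 2(g−1) = g·(2h − 2 + Σ_{j=1}^{l} (1 − 1/m_j)) (an equation of rational numbers). Then h = 0, l = 7, and exactly one of the m_j equals q while the remaining six all equal 2. -/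
/-- A divisor `m ≥ 2` of `2 * q`, with `q` prime, is one of `2`, `q`, `2 * q`; in each case
`e` is the number for which `1 - 1 / m = (q + e) / (2 * q)`. -/
theorem exists_excess_of_dvd_two_mul_prime {q m : ℕ} (hq : q.Prime) (hm : 2 ≤ m)
    (hdvd : m ∣ 2 * q) :
    ∃ e : ℕ, (m = 2 ∧ e = 0 ∨ m = q ∧ e + 2 = q ∨ m = 2 * q ∧ e + 1 = q) ∧
      (1 - 1 / (m : ℚ)) = ((q : ℚ) + e) / (2 * q) := by
  have hq2 := hq.two_le
  have hq0 : (q : ℚ) ≠ 0 := by exact_mod_cast hq.ne_zero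
  obtain ⟨a, b, ha, hb, rfl⟩ := Nat.dvd_mul.mp hdvd
  rcases (Nat.dvd_prime Nat.prime_two).mp ha with rfl | rfl <;>
    rcases (Nat.dvd_prime hq).mp hb with rfl | rfl
  · omega
  · refine ⟨b - 2, by omega, ?_⟩
    push_cast [Nat.cast_sub hq2]
    field_simp
    ring
  · refine ⟨0, by omega, ?_⟩
    push_cast
    field_simp
    ring
  · refine ⟨b - 1, by omega, ?_⟩
    push_cast [Nat.cast_sub hq.one_le]
    field_simp
    ring

/-- Let `g ≥ 6` be an even integer such that `q = g/2` is prime. Suppose `h, l ≥ 0` are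
integers with `3h − 3 + l = 4`, and `m_1, …, m_l` are integers, each `≥ 2` and each
dividing `2q`, satisfying `2(g−1) = g·(2h − 2 + Σ (1 − 1/m_j))` in `ℚ`. Then `h = 0`,
`l = 7`, and exactly one of the `m_j` equals `q` while the remaining six all equal `2`. -/
theorem stmt_10 (g q : ℕ) (hg : 6 ≤ g) (hgq : g = 2 * q) (hq : Nat.Prime q)
    (h l : ℕ) (hhl : 3 * (h : ℤ) - 3 + (l : ℤ) = 4)
    (m : Fin l → ℕ) (hm : ∀ j, 2 ≤ m j) (hdvd : ∀ j, m j ∣ 2 * q)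
    (heq : 2 * ((g : ℚ) - 1) = (g : ℚ) * (2 * (h : ℚ) - 2 + ∑ j, (1 - 1 / (m j : ℚ)))) :
    h = 0 ∧ l = 7 ∧ ∃ j : Fin l, m j = q ∧ ∀ k, k ≠ j → m k = 2 := by
  choose e hcase he using fun j => exists_excess_of_dvd_two_mul_prime hq (hm j) (hdvd j)
  have hq0 : (q : ℚ) ≠ 0 := by exact_mod_cast hq.ne_zero
  have hlq : (l : ℚ) = 7 - 3 * h := by
    have hlz : (l : ℤ) = 7 - 3 * h := by omega
    exact_mod_cast hlz
  have hsum : ∑ j, e j + q * h + 2 = q := by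
    subst hgq
    rw [Finset.sum_congr rfl fun j _ => he j, ← Finset.sum_div, Finset.sum_add_distrib] at heq
    simp only [Finset.sum_const, Finset.card_univ, Fintype.card_fin, nsmul_eq_mul, hlq] at heq
    push_cast at heq
    field_simp at heq
    have hsumq : ∑ j, (e j : ℚ) + q * h + 2 = q := by linarith
    exact_mod_cast hsumq
  have hh : h = 0 := by
    by_contra hne
    have := Nat.le_mul_of_pos_right q (Nat.pos_of_ne_zero hne)
    omega
  subst hh
  refine ⟨rfl, by omega, ?_⟩
  obtain ⟨j, -, hj⟩ : ∃ j ∈ Finset.univ, e j ≠ 0 := by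
    refine Finset.exists_ne_zero_of_sum_ne_zero ?_
    omega
  have hsplit := Finset.add_sum_erase Finset.univ e (Finset.mem_univ j)
  have hcase_j := hcase j
  refine ⟨j, by omega, fun k hk => ?_⟩
  have hle : e k ≤ ∑ i ∈ Finset.univ.erase j, e i :=
    Finset.single_le_sum (fun _ _ => Nat.zero_le _) (by simp [hk])
  have hcase_k := hcase k
  omega
end

section
/- Let g ≥ 11 be an odd integer such that g − 1 = 2q where q is a prime number. Suppose h ≥ 0 and l ≥ 0 are integers with 3h − 3 + l = 4, and m_1, …, m_l are integers, each ≥ 2 and each dividing 2q, satisfying 2(g−1) = (g−1)·(2h − 2 + Σ_{j=1}^{l} (1 − 1/m_j)) (an equation of rational numbers). Then h = 1, l = 4, and m_j = 2 for every j = 1, …, 4. -/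
/-- A divisor `m ≥ 2` of `2 * q`, with `q` prime, is either `2` or at least `q`. -/
theorem eq_two_or_le_of_dvd_two_mul {q m : ℕ} (hq : q.Prime) (hm : 2 ≤ m) (h : m ∣ 2 * q) :
    m = 2 ∨ q ≤ m := by
  by_cases hqm : q ∣ m
  · exact Or.inr (Nat.le_of_dvd (by omega) hqm)
  · have hcop : Nat.Coprime m q := ((Nat.Prime.coprime_iff_not_dvd hq).2 hqm).symm
    exact Or.inl (le_antisymm (Nat.le_of_dvd two_pos (hcop.dvd_of_dvd_mul_right h)) hm)

/-- Seven positive rationals, each equal to `1 / 2` or at most `1 / 5`, never add up to `3`. -/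
theorem sum_ne_three_of_eq_half_or_le_fifth (x : Fin 7 → ℚ) (hpos : ∀ j, 0 < x j)
    (hx : ∀ j, x j = 1 / 2 ∨ x j ≤ 1 / 5) : ∑ j, x j ≠ 3 := by
  intro hsum
  by_cases hall : ∀ j, x j = 1 / 2
  · norm_num [hall] at hsum
  push Not at hall
  obtain ⟨k, hk⟩ := hall
  set a := (Finset.univ.filter fun j => x j = 1 / 2).card
  have hlower : ∑ j, (if x j = 1 / 2 then (1 / 2 : ℚ) else 0) < ∑ j, x j := by
    refine Finset.sum_lt_sum (fun j _ => ?_) ⟨k, Finset.mem_univ k, ?_⟩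
    · split_ifs with hj
      · exact hj.ge
      · exact (hpos j).le
    · rw [if_neg hk]
      exact hpos k
  have hupper : ∑ j, x j ≤ ∑ j, ((if x j = 1 / 2 then (3 / 10 : ℚ) else 0) + 1 / 5) := by
    refine Finset.sum_le_sum fun j _ => ?_
    split_ifs with hj
    · rw [hj]
      norm_num
    · linarith [(hx j).resolve_left hj]
  have hcount (c : ℚ) : ∑ j, (if x j = 1 / 2 then c else 0) = a * c := by
    rw [← Finset.sum_filter, Finset.sum_const, nsmul_eq_mul]
  rw [hcount, hsum] at hlower
  rw [Finset.sum_add_distrib, hcount, hsum, Finset.sum_const, Finset.card_univ,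
    Fintype.card_fin] at hupper
  have hlt : a < 6 := by
    have : (a : ℚ) < 6 := by linarith
    exact_mod_cast this
  have hgt : 5 < a := by
    have : (5 : ℚ) < a := by
      norm_num at hupper
      linarith
    exact_mod_cast this
  omega

/-- Let `g ≥ 11` be an odd integer such that `g − 1 = 2q` with `q` prime. Suppose
`h, l ≥ 0` are integers with `3h − 3 + l = 4`, and `m_1, …, m_l` are integers, each `≥ 2`
and each dividing `2q`, satisfying `2(g−1) = (g−1)·(2h − 2 + Σ (1 − 1/m_j))` in `ℚ`.
Then `h = 1`, `l = 4`, and `m_j = 2` for every `j`. -/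
theorem stmt_12 (g q : ℕ) (hg : 11 ≤ g) (hgodd : Odd g) (hgq : g - 1 = 2 * q)
    (hq : Nat.Prime q)
    (h l : ℕ) (hhl : 3 * (h : ℤ) - 3 + (l : ℤ) = 4)
    (m : Fin l → ℕ) (hm : ∀ j, 2 ≤ m j) (hdvd : ∀ j, m j ∣ 2 * q)
    (heq : 2 * ((g : ℚ) - 1) =
      ((g : ℚ) - 1) * (2 * (h : ℚ) - 2 + ∑ j, (1 - 1 / (m j : ℚ)))) :
    h = 1 ∧ l = 4 ∧ ∀ j, m j = 2 := by
  have hgQ : (g : ℚ) - 1 ≠ 0 := by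
    have : (11 : ℚ) ≤ g := by exact_mod_cast hg
    linarith
  have hsum : 2 * (h : ℚ) - 2 + ∑ j, (1 - 1 / (m j : ℚ)) = 2 :=
    (mul_left_cancel₀ hgQ (by linarith)).symm
  have hpos (j) : 0 < 1 / (m j : ℚ) := by
    have := hm j
    positivity
  have hhalf (j) : 1 / (m j : ℚ) ≤ 1 / 2 :=
    one_div_le_one_div_of_le two_pos (by exact_mod_cast hm j)
  have hfifth (j) : 1 / (m j : ℚ) = 1 / 2 ∨ 1 / (m j : ℚ) ≤ 1 / 5 := by
    rcases eq_two_or_le_of_dvd_two_mul hq (hm j) (hdvd j) with h2 | hle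
    · left
      rw [h2, Nat.cast_ofNat]
    · right
      exact one_div_le_one_div_of_le (by norm_num) (by exact_mod_cast (by omega : 5 ≤ m j))
  have hcases : (h = 0 ∧ l = 7) ∨ (h = 1 ∧ l = 4) ∨ (h = 2 ∧ l = 1) := by omega
  rcases hcases with ⟨rfl, rfl⟩ | ⟨rfl, rfl⟩ | ⟨rfl, rfl⟩
  · exfalso
    refine sum_ne_three_of_eq_half_or_le_fifth (fun j => 1 / (m j : ℚ)) hpos hfifth ?_
    rw [Finset.sum_sub_distrib, Finset.sum_const, Finset.card_univ, Fintype.card_fin] at hsum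
    norm_num at hsum ⊢
    linarith
  · refine ⟨rfl, rfl, fun j => ?_⟩
    simp only [Fin.sum_univ_four, Nat.cast_one] at hsum
    have := hhalf 0; have := hhalf 1; have := hhalf 2; have := hhalf 3
    have hj : 1 / (m j : ℚ) = 1 / 2 := by
      fin_cases j <;> dsimp <;> linarith
    have hj' : (m j : ℚ) = 2 := by simpa using hj
    exact_mod_cast hj'
  · exfalso
    simp only [Fin.sum_univ_one, Nat.cast_ofNat] at hsum
    linarith [hhalf 0]
end

section
/- Let g ≥ 7 be an integer with g ≡ 3 (mod 4) and set n = (g+1)/2. There exist seven elements a_1, …, a_7 of the dihedral group D_n such that a_1, …, a_6 each have order exactly 2, a_7 has order exactly (g+1)/4 = n/2, a_1·a_2·⋯·a_7 = 1, and {a_1, …, a_7} generates D_n. -/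
/-- Two adjacent reflections generate the dihedral group. -/
theorem DihedralGroup.eq_top_of_sr_zero_mem_of_sr_one_mem {n : ℕ}
    {H : Subgroup (DihedralGroup n)} (h0 : DihedralGroup.sr 0 ∈ H)
    (h1 : DihedralGroup.sr 1 ∈ H) : H = ⊤ := by
  have hr1 : DihedralGroup.r (1 : ZMod n) ∈ H := by
    simpa using H.mul_mem h0 h1
  have hr (i : ZMod n) : DihedralGroup.r i ∈ H := by
    obtain ⟨k, rfl⟩ := ZMod.intCast_surjective i
    simpa using H.zpow_mem hr1 k
  refine (Subgroup.eq_top_iff' H).2 fun x => ?_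
  cases x with
  | r i => exact hr i
  | sr i => simpa using H.mul_mem h0 (hr i)

/-- For even `n`, the rotation `r (-2)` has order `n / 2`. -/
theorem DihedralGroup.orderOf_r_neg_two {n : ℕ} (hn : 2 ∣ n) :
    orderOf (DihedralGroup.r (-2 : ZMod n)) = n / 2 := by
  have h : DihedralGroup.r (-2 : ZMod n) = (DihedralGroup.r 1 ^ 2)⁻¹ := by simp
  rw [h, orderOf_inv, orderOf_pow' _ two_ne_zero, DihedralGroup.orderOf_r_one,
    Nat.gcd_eq_right hn]



/-- Let `g ≥ 7` be an integer with `g ≡ 3 (mod 4)` and set `n = (g+1)/2`. There exist seven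
elements `a 0, …, a 6` of the dihedral group `D_n` such that `a 0, …, a 5` each have order
exactly 2, `a 6` has order exactly `(g+1)/4 = n/2`, their product is `1`, and they generate
`D_n`. -/
theorem stmt_13 (g : ℕ) (hg : 7 ≤ g) (hmod : g % 4 = 3) :
    ∃ a : Fin 7 → DihedralGroup ((g + 1) / 2),
      (∀ i : Fin 7, (i : ℕ) < 6 → orderOf (a i) = 2) ∧
      orderOf (a 6) = (g + 1) / 4 ∧
      a 0 * a 1 * a 2 * a 3 * a 4 * a 5 * a 6 = 1 ∧
      Subgroup.closure (Set.range a) = ⊤ := by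
  let a : Fin 7 → DihedralGroup ((g + 1) / 2) :=
    ![.sr 0, .sr 1, .sr 0, .sr 1, .sr 0, .sr 0, .r (-2)]
  refine ⟨a, fun i hi => ?_, ?_, ?_, ?_⟩
  · fin_cases i
    · exact DihedralGroup.orderOf_sr _
    · exact DihedralGroup.orderOf_sr _
    · exact DihedralGroup.orderOf_sr _
    · exact DihedralGroup.orderOf_sr _
    · exact DihedralGroup.orderOf_sr _
    · exact DihedralGroup.orderOf_sr _
    · exact absurd hi (lt_irrefl 6)
  · refine (DihedralGroup.orderOf_r_neg_two (by omega)).trans ?_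
    omega
  · change DihedralGroup.sr 0 * .sr 1 * .sr 0 * .sr 1 * .sr 0 * .sr 0 * .r (-2) = 1
    simp only [DihedralGroup.sr_mul_sr, DihedralGroup.r_mul_sr,
      DihedralGroup.r_mul_r, DihedralGroup.one_def]
    congr 1
    ring
  · exact DihedralGroup.eq_top_of_sr_zero_mem_of_sr_one_mem
      (Subgroup.subset_closure ⟨0, rfl⟩) (Subgroup.subset_closure ⟨1, rfl⟩)
end

section
/- Let g ≥ 4 be an integer with g ≡ 4 (mod 6) and set m = 2(g−1)/3. There exist seven elements a_1, …, a_7 of the dihedral group D_m, each of order exactly 2, such that a_1·a_2·⋯·a_7 = 1 and {a_1, …, a_7} generates D_m. -/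
namespace DihedralGroup

theorem orderOf_r_half {k : ℕ} (hk : 0 < k) :
    orderOf (r (k : ZMod (2 * k)) : DihedralGroup (2 * k)) = 2 := by
  refine orderOf_eq_prime ?_ fun h => ?_
  · rw [r_pow, ← Nat.cast_mul, mul_comm k 2, ZMod.natCast_self, r_zero]
  · rw [one_def, r.injEq, ZMod.natCast_eq_zero_iff] at h
    have := Nat.le_of_dvd hk h
    omega

theorem eq_top_of_sr_zero_mem_of_sr_one_mem_s14 {n : ℕ} {H : Subgroup (DihedralGroup n)}
    (h₀ : sr 0 ∈ H) (h₁ : sr 1 ∈ H) : H = ⊤ := by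
  have hr (i : ZMod n) : r i ∈ H := by
    obtain ⟨j, rfl⟩ := ZMod.intCast_surjective i
    rw [← r_one_zpow]
    exact H.zpow_mem (by simpa using H.mul_mem h₀ h₁) j
  refine (Subgroup.eq_top_iff' H).2 ?_
  rintro (i | i)
  · exact hr i
  · simpa using H.mul_mem h₀ (hr i)

end DihedralGroup

/-- Let `g ≥ 4` be an integer with `g ≡ 4 (mod 6)` and set `m = 2(g−1)/3`. There exist
seven elements `a 0, …, a 6` of the dihedral group `D_m`, each of order exactly 2, whose
product is `1` and which generate `D_m`. -/
theorem stmt_14 (g : ℕ) (hg : 4 ≤ g) (hmod : g % 6 = 4) :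
    ∃ a : Fin 7 → DihedralGroup (2 * (g - 1) / 3),
      (∀ i, orderOf (a i) = 2) ∧
      a 0 * a 1 * a 2 * a 3 * a 4 * a 5 * a 6 = 1 ∧
      Subgroup.closure (Set.range a) = ⊤ := by
  obtain ⟨k, hk, hm⟩ : ∃ k, 0 < k ∧ 2 * (g - 1) / 3 = 2 * k := ⟨(g - 1) / 3, by omega, by omega⟩
  rw [hm]
  open DihedralGroup in
  refine ⟨![r k, sr 0, sr k, sr 0, sr 0, sr 1, sr 1], fun i => ?_, ?_, ?_⟩
  · fin_cases i
    · exact orderOf_r_half hk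
    all_goals exact orderOf_sr _
  · have h : (k : ZMod (2 * k)) + k = 0 := by
      rw [← Nat.cast_add, ← two_mul, ZMod.natCast_self]
    simp [h]
  · exact eq_top_of_sr_zero_mem_of_sr_one_mem_s14 (Subgroup.subset_closure ⟨1, rfl⟩)
      (Subgroup.subset_closure ⟨5, rfl⟩)
end
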